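/- arXiv:2007.15335 — 4 statements merged into one kernel-verified Lean document; each statement's English description precedes it below -/
import Mathlib

section
/- Let n ≥ 1, let x be a random vector in ℝⁿ with multivariate Gaussian distribution N(m, S) where S is positive definite, fix an index k and censoring limits a < b, and let x^c be the censored vector whose i-th coordinate is x_i for i ≠ k and whose k-th coordinate is clip_{a,b}(x_k). Then for every t ∈ ℝⁿ the moment generating function of x^c satisfies E[exp(tᵀx^c)] = exp(tᵀm + (1/2)tᵀSt)·(F_{e_k}(b − m_k − (St)_k) − F_{e_k}(a − m_k − (St)_k)) + exp(t_k·a + t₀ᵀm + (1/2)t₀ᵀSt₀)·F_{e_k}(a − m_k − (St₀)_k) + exp(t_k·b + t₀ᵀm + (1/2)t₀ᵀSt₀)·(1 − F_{e_k}(b − m_k − (St₀)_k)), where t₀ ∈ ℝⁿ is the vector t with its k-th coordinate replaced by 0. -/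
open MeasureTheory ProbabilityTheory Real

/-- The standard normal cumulative distribution function Φ. -/
noncomputable def stdNormalCDF (x : ℝ) : ℝ :=
  ((gaussianReal 0 1) (Set.Iic x)).toReal

/-- The standard normal probability density function φ. -/
noncomputable def stdNormalPDF (x : ℝ) : ℝ :=
  gaussianPDFReal 0 1 x

/-- The censoring (clipping) map: `clip a b x = x` if `a < x < b`,
`= a` if `x ≤ a`, `= b` if `x ≥ b` (for `a < b`). -/
noncomputable def clip (a b x : ℝ) : ℝ := max a (min b x)
/-- A random vector `X` has the multivariate Gaussian distribution `N(m, S)` iff every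
linear combination `∑ i, t i * X i` is Gaussian with mean `tᵀm` and variance `tᵀSt`. -/
def IsGaussianVector {Ω : Type*} [MeasureSpace Ω] {ι : Type*} [Fintype ι]
    (X : Ω → ι → ℝ) (m : ι → ℝ) (S : Matrix ι ι ℝ) : Prop :=
  ∀ t : ι → ℝ,
    Measure.map (fun ω => ∑ i, t i * X ω i) ℙ =
      gaussianReal (∑ i, t i * m i) ((∑ i, ∑ j, t i * S i j * t j).toNNReal)

/-- If the joint exponential moments `E[exp (Y + s Z)]` are those of a Gaussian in `s`, up to a
constant factor, then `Z` is Gaussian under the measure tilted by `Y`. -/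
lemma map_tilted_eq_gaussianReal {Ω : Type*} [MeasurableSpace Ω] {P : Measure Ω}
    {Y Z : Ω → ℝ} (hZ : Measurable Z) {C μ : ℝ} {v : NNReal} (hC : 0 < C)
    (h : ∀ s : ℝ, ∫ ω, exp (Y ω + s * Z ω) ∂P = C * exp (μ * s + v * s ^ 2 / 2)) :
    (P.tilted Y).map Z = gaussianReal μ v := by
  have hY : ∫ ω, exp (Y ω) ∂P = C := by simpa using h 0
  have hint : Integrable (fun ω => exp (Y ω)) P := by
    by_contra hn
    rw [integral_undef hn] at hY
    exact hC.ne hY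
  have : NeZero P := ⟨by rintro rfl; simp at hY; exact hC.ne hY⟩
  have := isProbabilityMeasure_tilted hint
  have hmgf : mgf Z (P.tilted Y) = mgf id (gaussianReal μ v) := by
    ext s
    rw [mgf_id_gaussianReal, mgf, integral_exp_tilted, hY]
    simp only [Pi.add_apply]
    rw [h s, mul_div_cancel_left₀ _ hC.ne']
  have hset : integrableExpSet Z (P.tilted Y) = Set.univ := by
    ext s
    simp only [integrableExpSet, Set.mem_ofPred_eq, Set.mem_univ, iff_true]
    rw [← mgf_pos_iff, hmgf, mgf_id_gaussianReal]
    exact exp_pos _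
  have key := Measure.ext_of_complexMGF_eq (μ := P.tilted Y) (μ' := gaussianReal μ v)
    hZ.aemeasurable aemeasurable_id (by
      ext z
      exact eqOn_complexMGF_of_mgf hmgf (by simp [hset]))
  simpa using key

lemma setIntegral_exp_eq_mul_gaussianReal {Ω : Type*} [MeasurableSpace Ω] {P : Measure Ω}
    {Y Z : Ω → ℝ} (hZ : Measurable Z) {C μ : ℝ} {v : NNReal} (hC : 0 < C)
    (h : ∀ s : ℝ, ∫ ω, exp (Y ω + s * Z ω) ∂P = C * exp (μ * s + v * s ^ 2 / 2))
    {A : Set ℝ} (hA : MeasurableSet A) :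
    ∫ ω in Z ⁻¹' A, exp (Y ω) ∂P = C * (gaussianReal μ v).real A := by
  have hY : ∫ ω, exp (Y ω) ∂P = C := by simpa using h 0
  rw [← map_tilted_eq_gaussianReal hZ hC h, measureReal_def, Measure.map_apply hZ hA,
    tilted_apply_eq_ofReal_integral' _ (hZ hA), hY, integral_div, ENNReal.toReal_ofReal,
    mul_div_cancel₀ _ hC.ne']
  positivity

lemma gaussianReal_real_Iic (μ : ℝ) {v : NNReal} (hv : v ≠ 0) (c : ℝ) :
    (gaussianReal μ v).real (Set.Iic c) = stdNormalCDF ((c - μ) / √v) := by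
  have hpos : 0 < √(v : ℝ) := Real.sqrt_pos.2 (by positivity)
  have hmap : (gaussianReal μ v).map (fun x => (x - μ) / √v) = gaussianReal 0 1 := by
    have := (gaussianReal_div_const
      (gaussianReal_sub_const (HasLaw.id (μ := gaussianReal μ v)) μ) (√v)).map_eq
    rw [show (fun x => (x - μ) / √(v : ℝ)) = fun x => (id x - μ) / √(v : ℝ) from rfl, this]
    congr 1
    · simp
    · ext
      simp [hv]
  rw [stdNormalCDF, ← hmap, Measure.map_apply (by fun_prop) measurableSet_Iic, measureReal_def]
  congr 2
  ext x
  simp [div_le_div_iff_of_pos_right hpos]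

/-- Exponential moments of a Gaussian vector. -/
lemma IsGaussianVector.integral_exp {Ω : Type*} [MeasureSpace Ω] {ι : Type*} [Fintype ι]
    {X : Ω → ι → ℝ} {m : ι → ℝ} {S : Matrix ι ι ℝ} (hX : IsGaussianVector X m S)
    (hS : S.PosSemidef) (t : ι → ℝ) :
    ∫ ω, exp (∑ i, t i * X ω i) =
      exp ((∑ i, t i * m i) + (1 / 2) * ∑ i, ∑ j, t i * S i j * t j) := by
  have hq : 0 ≤ ∑ i, ∑ j, t i * S i j * t j := by
    have := hS.dotProduct_mulVec_nonneg t
    simpa [dotProduct, Matrix.mulVec, Finset.mul_sum, mul_assoc] using this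
  have := mgf_gaussianReal (hX t) 1
  simp only [mgf, one_mul, mul_one, one_pow, Real.coe_toNNReal _ hq] at this
  rw [this]
  ring_nf

lemma IsGaussianVector.integral_exp_add_mul {Ω : Type*} [MeasureSpace Ω] {ι : Type*} [Fintype ι]
    {X : Ω → ι → ℝ} {m : ι → ℝ} {S : Matrix ι ι ℝ} (hX : IsGaussianVector X m S)
    (hS : S.PosSemidef) (t : ι → ℝ) (k : ι) (s : ℝ) :
    ∫ ω, exp ((∑ i, t i * X ω i) + s * X ω k) =
      exp ((∑ i, t i * m i) + (1 / 2) * ∑ i, ∑ j, t i * S i j * t j) *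
        exp ((m k + ∑ i, S k i * t i) * s + (S k k).toNNReal * s ^ 2 / 2) := by
  classical
  have hsymm (i j : ι) : S i j = S j i := by simpa using (hS.1.apply i j).symm
  have h := hX.integral_exp hS (fun i => t i + if i = k then s else 0)
  have hkk : 0 ≤ S k k := hS.diag_nonneg
  simp only [add_mul, mul_add, ite_mul, mul_ite, zero_mul, mul_zero, Finset.sum_add_distrib,
    Finset.sum_ite_eq', Finset.mem_univ, if_true] at h
  rw [h, ← exp_add, Real.coe_toNNReal _ hkk]
  congr 1
  have e1 : ∑ i, t i * S i k * s = s * ∑ i, S k i * t i := by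
    rw [Finset.mul_sum]
    exact Finset.sum_congr rfl fun i _ => by rw [hsymm i k]; ring
  have e2 : ∑ i, ∑ j, (if i = k then s * S i j * t j else 0) = s * ∑ i, S k i * t i := by
    rw [Finset.sum_comm, Finset.mul_sum]
    exact Finset.sum_congr rfl fun i _ => by simp [mul_assoc]
  rw [e1, e2]
  ring

/-- Exponential moments of a Gaussian vector on an event determined by one coordinate. -/
lemma IsGaussianVector.setIntegral_exp {Ω : Type*} [MeasureSpace Ω] {ι : Type*} [Fintype ι]
    {X : Ω → ι → ℝ} {m : ι → ℝ} {S : Matrix ι ι ℝ} (hX : IsGaussianVector X m S)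
    (hXm : Measurable X) (hS : S.PosSemidef) (t : ι → ℝ) (k : ι) {A : Set ℝ}
    (hA : MeasurableSet A) :
    ∫ ω in {ω | X ω k ∈ A}, exp (∑ i, t i * X ω i) =
      exp ((∑ i, t i * m i) + (1 / 2) * ∑ i, ∑ j, t i * S i j * t j) *
        (gaussianReal (m k + ∑ i, S k i * t i) (S k k).toNNReal).real A :=
  setIntegral_exp_eq_mul_gaussianReal (Z := fun ω => X ω k) (by fun_prop) (exp_pos _)
    (hX.integral_exp_add_mul hS t k) hA

lemma IsGaussianVector.integrable_exp {Ω : Type*} [MeasureSpace Ω] {ι : Type*} [Fintype ι]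
    {X : Ω → ι → ℝ} {m : ι → ℝ} {S : Matrix ι ι ℝ} (hX : IsGaussianVector X m S)
    (hS : S.PosSemidef) (t : ι → ℝ) :
    Integrable (fun ω => exp (∑ i, t i * X ω i)) := by
  by_contra hn
  have := hX.integral_exp hS t
  rw [integral_undef hn] at this
  exact (exp_pos _).ne this

lemma sum_mul_ite_eq {ι : Type*} [Fintype ι] [DecidableEq ι] (t x : ι → ℝ) (k : ι) (c : ℝ) :
    ∑ i, t i * (if i = k then c else x i) =
      t k * c + ∑ i, Function.update t k 0 i * x i := by
  rw [← Finset.add_sum_erase _ _ (Finset.mem_univ k),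
    ← Finset.add_sum_erase (f := fun i => Function.update t k 0 i * x i) _ (Finset.mem_univ k)]
  simp only [if_true, Function.update_self, zero_mul, zero_add]
  congr 1
  refine Finset.sum_congr rfl fun i hi => ?_
  simp [Finset.ne_of_mem_erase hi]

theorem censored_mgf_multivariate {Ω : Type*} [MeasureSpace Ω]
    [IsProbabilityMeasure (ℙ : Measure Ω)]
    {n : ℕ} (hn : 1 ≤ n)
    (X : Ω → Fin n → ℝ) (hXm : Measurable X)
    (m : Fin n → ℝ) (S : Matrix (Fin n) (Fin n) ℝ) (hS : S.PosDef)
    (hX : IsGaussianVector X m S)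
    (k : Fin n) (a b : ℝ) (hab : a < b) (t : Fin n → ℝ) :
    ∫ ω, Real.exp (∑ i, t i * (if i = k then clip a b (X ω k) else X ω i)) ∂ℙ =
      Real.exp ((∑ i, t i * m i) + (1 / 2) * ∑ i, ∑ j, t i * S i j * t j) *
          (stdNormalCDF ((b - m k - ∑ i, S k i * t i) / Real.sqrt (S k k))
            - stdNormalCDF ((a - m k - ∑ i, S k i * t i) / Real.sqrt (S k k)))
        + Real.exp (t k * a + (∑ i, Function.update t k 0 i * m i)
              + (1 / 2) * ∑ i, ∑ j, Function.update t k 0 i * S i j * Function.update t k 0 j) *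
          stdNormalCDF ((a - m k - ∑ i, S k i * Function.update t k 0 i) / Real.sqrt (S k k))
        + Real.exp (t k * b + (∑ i, Function.update t k 0 i * m i)
              + (1 / 2) * ∑ i, ∑ j, Function.update t k 0 i * S i j * Function.update t k 0 j) *
          (1 - stdNormalCDF ((b - m k - ∑ i, S k i * Function.update t k 0 i)
            / Real.sqrt (S k k))) := by
  have hps := hS.posSemidef
  have hkk : 0 < S k k := hS.diag_pos
  have hv : (S k k).toNNReal ≠ 0 := by simpa using hkk
  have hcdf (μ c : ℝ) : (gaussianReal (m k + μ) (S k k).toNNReal).real (Set.Iic c) =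
      stdNormalCDF ((c - m k - μ) / √(S k k)) := by
    rw [gaussianReal_real_Iic _ hv, Real.coe_toNNReal _ hkk.le, sub_sub]
  set t₀ := Function.update t k 0
  set f := fun ω => exp (∑ i, t i * X ω i)
  set g := fun ω => exp (∑ i, t₀ i * X ω i)
  have hf : Integrable f := hX.integrable_exp hps t
  have hg : Integrable g := hX.integrable_exp hps t₀
  have hmeas {A : Set ℝ} (hA : MeasurableSet A) : MeasurableSet {ω | X ω k ∈ A} :=
    (show Measurable fun ω => X ω k by fun_prop) hA
  have hsplit (ω : Ω) :
      exp (∑ i, t i * (if i = k then clip a b (X ω k) else X ω i)) =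
        {ω | X ω k ∈ Set.Ioc a b}.indicator f ω
          + exp (t k * a) * {ω | X ω k ∈ Set.Iic a}.indicator g ω
          + exp (t k * b) * {ω | X ω k ∈ Set.Ioi b}.indicator g ω := by
    have hfω : f ω = exp (t k * X ω k) * g ω := by
      have := sum_mul_ite_eq t (X ω) k (X ω k)
      rw [← exp_add, ← this]
      refine congrArg exp (Finset.sum_congr rfl fun i _ => ?_)
      split_ifs with h <;> simp [h]
    rw [sum_mul_ite_eq, exp_add]
    change _ * g ω = _
    rcases le_or_gt (X ω k) a with h | h
    · have : clip a b (X ω k) = a := by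
        rw [clip, min_eq_right (h.trans hab.le), max_eq_left h]
      simp [Set.indicator, this, h, not_lt.2 h, not_lt.2 (h.trans hab.le)]
    · rcases le_or_gt (X ω k) b with h' | h'
      · have : clip a b (X ω k) = X ω k := by
          rw [clip, min_eq_right h', max_eq_right h.le]
        simp [Set.indicator, this, h, h', not_le.2 h, not_lt.2 h', hfω]
      · have : clip a b (X ω k) = b := by
          rw [clip, min_eq_left h'.le, max_eq_right hab.le]
        simp [Set.indicator, this, h', not_le.2 h, not_le.2 h']
  simp_rw [hsplit]
  have i1 := hf.indicator (hmeas (measurableSet_Ioc (a := a) (b := b)))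
  have i2 := (hg.indicator (hmeas (measurableSet_Iic (a := a)))).const_mul (exp (t k * a))
  have i3 := (hg.indicator (hmeas (measurableSet_Ioi (a := b)))).const_mul (exp (t k * b))
  have i12 : Integrable fun ω => {ω | X ω k ∈ Set.Ioc a b}.indicator f ω
      + exp (t k * a) * {ω | X ω k ∈ Set.Iic a}.indicator g ω := i1.add i2
  rw [integral_add i12 i3, integral_add i1 i2, integral_const_mul, integral_const_mul,
    integral_indicator (hmeas measurableSet_Ioc), integral_indicator (hmeas measurableSet_Iic),
    integral_indicator (hmeas measurableSet_Ioi),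
    hX.setIntegral_exp hXm hps t k measurableSet_Ioc,
    hX.setIntegral_exp hXm hps t₀ k measurableSet_Iic,
    hX.setIntegral_exp hXm hps t₀ k measurableSet_Ioi,
    ← Set.Iic_sdiff_Iic, measureReal_sdiff (Set.Iic_subset_Iic.2 hab.le) measurableSet_Iic,
    ← Set.compl_Iic, probReal_compl_eq_one_sub measurableSet_Iic, hcdf, hcdf, hcdf, hcdf,
    add_assoc (t k * a), add_assoc (t k * b), exp_add (t k * a), exp_add (t k * b)]
  ring
end

section
/- Let X be a real random variable with Gaussian distribution N(m, s²), s > 0, and let a < b be censoring limits. Then for every t ∈ ℝ, E[exp(t·clip_{a,b}(X))] = exp(t·m + t²s²/2)·(Φ((b − m − s²t)/s) − Φ((a − m − s²t)/s)) + exp(t·a)·Φ((a − m)/s) + exp(t·b)·(1 − Φ((b − m)/s)). -/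
open MeasureTheory ProbabilityTheory Real

theorem gaussianReal_real_Iic_s2 (m x : ℝ) {s : ℝ} (hs : 0 < s) :
    (gaussianReal m (s ^ 2).toNNReal).real (Set.Iic x) = stdNormalCDF ((x - m) / s) := by
  have h : gaussianReal m (s ^ 2).toNNReal
      = (gaussianReal 0 1).map (fun z => s * z + m) := by
    have h₁ := gaussianReal_map_const_mul (μ := 0) (v := 1) s
    have h₂ := gaussianReal_map_add_const (μ := 0) (v := (s ^ 2).toNNReal) m
    have h₃ : NNReal.mk (s ^ 2) (sq_nonneg s) * 1 = (s ^ 2).toNNReal := by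
      rw [mul_one, Real.toNNReal_of_nonneg (sq_nonneg s)]
    rw [mul_zero, h₃] at h₁
    rw [zero_add, ← h₁, Measure.map_map (by fun_prop) (by fun_prop)] at h₂
    exact h₂.symm
  rw [h, map_measureReal_apply (by fun_prop) measurableSet_Iic, stdNormalCDF, Measure.real]
  congr 2
  ext z
  simp only [Set.mem_preimage, Set.mem_Iic]
  rw [le_div_iff₀ hs, le_sub_iff_add_le, mul_comm]

theorem setIntegral_exp_mul_gaussianReal (m t : ℝ) {v : NNReal} (hv : v ≠ 0) {S : Set ℝ}
    (hS : MeasurableSet S) :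
    ∫ x in S, Real.exp (t * x) ∂(gaussianReal m v) =
      Real.exp (t * m + t ^ 2 * v / 2) * (gaussianReal (m + v * t) v).real S := by
  have hv' : (v : ℝ) ≠ 0 := by exact_mod_cast hv
  have hr : (gaussianReal (m + v * t) v).real S
      = ∫ x, S.indicator (fun _ => (1 : ℝ)) x ∂(gaussianReal (m + v * t) v) := by
    rw [integral_indicator hS]
    simp
  rw [hr, ← integral_indicator hS, integral_gaussianReal_eq_integral_smul hv,
    integral_gaussianReal_eq_integral_smul hv, ← integral_const_mul]
  congr 1
  ext x
  by_cases hx : x ∈ S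
  · simp only [hx, Set.indicator_of_mem, smul_eq_mul, mul_one, gaussianPDFReal_def]
    rw [mul_assoc, ← Real.exp_add, mul_left_comm, ← Real.exp_add]
    congr 2
    field_simp
    ring
  · simp [hx]

theorem exp_mul_clip_eq_indicator {a b : ℝ} (hab : a < b) (t x : ℝ) :
    Real.exp (t * clip a b x) =
      (Set.Ioc a b).indicator (fun y => Real.exp (t * y)) x
        + (Set.Iic a).indicator (fun _ => Real.exp (t * a)) x
        + (Set.Ioi b).indicator (fun _ => Real.exp (t * b)) x := by
  unfold clip
  rcases le_or_gt x a with hxa | hxa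
  · have hxb : x ≤ b := hxa.trans hab.le
    simp [hxa, hxb, hxa.not_gt, hxb.not_gt]
  · rcases le_or_gt x b with hxb | hxb
    · simp [hxa, hxb, hxa.le, hxa.not_ge, hxb.not_gt]
    · simp [hxa, hxb, hxb.le, hab.le, hxa.not_ge, hxb.not_ge]

theorem censored_mgf_one_dim {Ω : Type*} [MeasureSpace Ω]
    [IsProbabilityMeasure (ℙ : Measure Ω)]
    (X : Ω → ℝ) (hXm : Measurable X) (m s a b : ℝ) (hs : 0 < s) (hab : a < b)
    (hX : Measure.map X ℙ = gaussianReal m ((s ^ 2).toNNReal)) (t : ℝ) :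
    ∫ ω, Real.exp (t * clip a b (X ω)) ∂ℙ =
      Real.exp (t * m + t ^ 2 * s ^ 2 / 2) *
          (stdNormalCDF ((b - m - s ^ 2 * t) / s) - stdNormalCDF ((a - m - s ^ 2 * t) / s))
        + Real.exp (t * a) * stdNormalCDF ((a - m) / s)
        + Real.exp (t * b) * (1 - stdNormalCDF ((b - m) / s)) := by
  have hv : (s ^ 2).toNNReal ≠ 0 := (Real.toNNReal_pos.mpr (by positivity)).ne'
  have hc : ((s ^ 2).toNNReal : ℝ) = s ^ 2 := Real.coe_toNNReal _ (sq_nonneg s)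
  have hmeas : Measurable fun x => Real.exp (t * clip a b x) := by
    unfold clip
    fun_prop
  have hIoc : (gaussianReal (m + s ^ 2 * t) (s ^ 2).toNNReal).real (Set.Ioc a b) =
      stdNormalCDF ((b - m - s ^ 2 * t) / s) - stdNormalCDF ((a - m - s ^ 2 * t) / s) := by
    rw [← Set.Iic_sdiff_Iic, measureReal_sdiff (Set.Iic_subset_Iic.mpr hab.le) measurableSet_Iic,
      gaussianReal_real_Iic_s2 _ _ hs, gaussianReal_real_Iic_s2 _ _ hs, sub_sub, sub_sub]
  have hIoi : (gaussianReal m (s ^ 2).toNNReal).real (Set.Ioi b) =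
      1 - stdNormalCDF ((b - m) / s) := by
    rw [← Set.compl_Iic, probReal_compl_eq_one_sub measurableSet_Iic,
      gaussianReal_real_Iic_s2 _ _ hs]
  rw [← integral_map (φ := X) (f := fun x => Real.exp (t * clip a b x)) hXm.aemeasurable
    hmeas.aestronglyMeasurable, hX]
  simp_rw [exp_mul_clip_eq_indicator hab]
  have hi₁ := (integrable_exp_mul_gaussianReal (μ := m) (v := (s ^ 2).toNNReal) t).indicator
    (measurableSet_Ioc (a := a) (b := b))
  have hi₂ := (integrable_const (μ := gaussianReal m (s ^ 2).toNNReal)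
    (Real.exp (t * a))).indicator (measurableSet_Iic (a := a))
  have hi₃ := (integrable_const (μ := gaussianReal m (s ^ 2).toNNReal)
    (Real.exp (t * b))).indicator (measurableSet_Ioi (a := b))
  rw [integral_add (by exact hi₁.add hi₂) hi₃, integral_add hi₁ hi₂,
    integral_indicator measurableSet_Ioc, integral_indicator measurableSet_Iic,
    integral_indicator measurableSet_Ioi, setIntegral_exp_mul_gaussianReal _ _ hv measurableSet_Ioc,
    setIntegral_const, setIntegral_const, hc, hIoc, hIoi, gaussianReal_real_Iic_s2 _ _ hs]
  simp only [smul_eq_mul]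
  ring
end

section
/- Let X be a real random variable with Gaussian distribution N(m, s²), s > 0, let a < b be censoring limits, and set a* = (a − m)/s, b* = (b − m)/s, and P = Φ(b*) − Φ(a*). Then the second moment of the censored variable satisfies E[(clip_{a,b}(X))²] = a²·Φ(a*) + b²·(1 − Φ(b*)) + (m² + s²)·P + 2ms·(φ(a*) − φ(b*)) + s²·(a*·φ(a*) − b*·φ(b*)). -/
open MeasureTheory ProbabilityTheory Real

theorem hasDerivAt_stdNormalPDF (x : ℝ) :
    HasDerivAt stdNormalPDF (-x * stdNormalPDF x) x := by
  have hpdf : stdNormalPDF = fun y => (√(2 * π))⁻¹ * rexp (-y ^ 2 / 2) := by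
    ext y
    simp [stdNormalPDF, gaussianPDFReal_def]
  have h : HasDerivAt (fun y : ℝ => -y ^ 2 / 2) (-x) x :=
    ((hasDerivAt_pow 2 x).neg.div_const 2).congr_deriv (by simp; ring)
  rw [hpdf]
  exact (h.exp.const_mul (√(2 * π))⁻¹).congr_deriv (by ring)

theorem continuous_stdNormalPDF : Continuous stdNormalPDF :=
  continuous_iff_continuousAt.2 fun x => (hasDerivAt_stdNormalPDF x).continuousAt

theorem setIntegral_Ioc_stdGaussian (f : ℝ → ℝ) {A B : ℝ} (hAB : A ≤ B) :
    ∫ x in Set.Ioc A B, f x ∂(gaussianReal 0 1) = ∫ x in A..B, stdNormalPDF x * f x := by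
  rw [← integral_indicator measurableSet_Ioc,
    integral_gaussianReal_eq_integral_smul one_ne_zero, intervalIntegral.integral_of_le hAB,
    ← integral_indicator measurableSet_Ioc]
  congr 1 with x
  simp [Set.indicator_apply, stdNormalPDF]

theorem measureReal_Ioc_stdGaussian {A B : ℝ} (hAB : A ≤ B) :
    (gaussianReal 0 1).real (Set.Ioc A B) = stdNormalCDF B - stdNormalCDF A := by
  rw [← Set.Iic_sdiff_Iic, measureReal_sdiff (Set.Iic_subset_Iic.2 hAB) measurableSet_Iic]
  rfl

theorem measureReal_Ioi_stdGaussian (B : ℝ) :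
    (gaussianReal 0 1).real (Set.Ioi B) = 1 - stdNormalCDF B := by
  rw [← Set.compl_Iic, probReal_compl_eq_one_sub measurableSet_Iic]
  rfl

theorem integral_stdNormalPDF {A B : ℝ} (hAB : A ≤ B) :
    ∫ x in A..B, stdNormalPDF x = stdNormalCDF B - stdNormalCDF A := by
  simpa [measureReal_Ioc_stdGaussian hAB] using (setIntegral_Ioc_stdGaussian (fun _ => 1) hAB).symm

/-- The truncated second moment of an affine function of a standard Gaussian. -/
theorem setIntegral_Ioc_affine_sq_stdGaussian (m s : ℝ) {A B : ℝ} (hAB : A ≤ B) :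
    ∫ x in Set.Ioc A B, (m + s * x) ^ 2 ∂(gaussianReal 0 1) =
      (m ^ 2 + s ^ 2) * (stdNormalCDF B - stdNormalCDF A)
        + 2 * m * s * (stdNormalPDF A - stdNormalPDF B)
        + s ^ 2 * (A * stdNormalPDF A - B * stdNormalPDF B) := by
  have hφ := continuous_stdNormalPDF
  have hderiv (x : ℝ) : HasDerivAt (fun y => -(2 * m * s + s ^ 2 * y) * stdNormalPDF y)
      (stdNormalPDF x * (m + s * x) ^ 2 - (m ^ 2 + s ^ 2) * stdNormalPDF x) x := by
    have h := ((((hasDerivAt_id x).const_mul (s ^ 2)).const_add (2 * m * s)).neg).mul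
      (hasDerivAt_stdNormalPDF x)
    refine h.congr_deriv ?_
    simp; ring
  have hint := intervalIntegral.integral_eq_sub_of_hasDerivAt (fun x _ => hderiv x)
    (Continuous.intervalIntegrable (by fun_prop) A B)
  rw [intervalIntegral.integral_sub (Continuous.intervalIntegrable (by fun_prop) A B)
    (Continuous.intervalIntegrable (by fun_prop) A B), intervalIntegral.integral_const_mul,
    integral_stdNormalPDF hAB] at hint
  rw [setIntegral_Ioc_stdGaussian _ hAB]
  linear_combination hint

theorem continuous_clip (a b : ℝ) : Continuous (clip a b) := by
  unfold clip; fun_prop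

theorem abs_clip_le {a b : ℝ} (hab : a < b) (x : ℝ) : |clip a b x| ≤ max |a| |b| :=
  abs_le_max_abs_abs (le_max_left _ _) (max_le hab.le (min_le_left _ _))

theorem integral_eq_integral_Iic_add_Ioc_add_Ioi {μ : Measure ℝ} {f : ℝ → ℝ}
    (hf : Integrable f μ) {A B : ℝ} (hAB : A ≤ B) :
    ∫ x, f x ∂μ = ∫ x in Set.Iic A, f x ∂μ + ∫ x in Set.Ioc A B, f x ∂μ
      + ∫ x in Set.Ioi B, f x ∂μ := by
  rw [← setIntegral_union (Set.Iic_disjoint_Ioc le_rfl) measurableSet_Ioc hf.integrableOn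
    hf.integrableOn, Set.Iic_union_Ioc_eq_Iic hAB, ← Set.compl_Iic,
    integral_add_compl measurableSet_Iic hf]

theorem censored_second_moment {Ω : Type*} [MeasureSpace Ω]
    [IsProbabilityMeasure (ℙ : Measure Ω)]
    (X : Ω → ℝ) (hXm : Measurable X) (m s a b : ℝ) (hs : 0 < s) (hab : a < b)
    (hX : Measure.map X ℙ = gaussianReal m ((s ^ 2).toNNReal)) :
    ∫ ω, (clip a b (X ω)) ^ 2 ∂ℙ =
      a ^ 2 * stdNormalCDF ((a - m) / s) + b ^ 2 * (1 - stdNormalCDF ((b - m) / s))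
        + (m ^ 2 + s ^ 2) * (stdNormalCDF ((b - m) / s) - stdNormalCDF ((a - m) / s))
        + 2 * m * s * (stdNormalPDF ((a - m) / s) - stdNormalPDF ((b - m) / s))
        + s ^ 2 * ((a - m) / s * stdNormalPDF ((a - m) / s)
            - (b - m) / s * stdNormalPDF ((b - m) / s)) := by
  have hmap : Measure.map (fun x => m + s * x) (gaussianReal 0 1)
      = gaussianReal m ((s ^ 2).toNNReal) := by
    have h : (fun x : ℝ => m + s * x) = (fun x => m + x) ∘ (fun x => s * x) := rfl
    rw [h, ← Measure.map_map (by fun_prop) (by fun_prop), gaussianReal_map_const_mul,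
      gaussianReal_map_const_add]
    congr 1
    · ring
    · ext; simp [sq_nonneg]
  have hclip := continuous_clip a b
  have hlaw : ∫ ω, (clip a b (X ω)) ^ 2 ∂ℙ
      = ∫ x, (clip a b (m + s * x)) ^ 2 ∂(gaussianReal 0 1) := by
    rw [← integral_map (f := fun x => clip a b x ^ 2) hXm.aemeasurable
        (Continuous.aestronglyMeasurable (by fun_prop)), hX, ← hmap,
      integral_map (by fun_prop) (Continuous.aestronglyMeasurable (by fun_prop))]
  have hint : Integrable (fun x => (clip a b (m + s * x)) ^ 2) (gaussianReal 0 1) := by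
    refine Integrable.of_bound (Continuous.aestronglyMeasurable (by fun_prop))
      (max |a| |b| ^ 2) (.of_forall fun x => ?_)
    rw [norm_pow]
    exact pow_le_pow_left₀ (norm_nonneg _) (abs_clip_le hab _) 2
  have hAB : (a - m) / s ≤ (b - m) / s := by gcongr
  have hlow : ∫ x in Set.Iic ((a - m) / s), (clip a b (m + s * x)) ^ 2 ∂(gaussianReal 0 1)
      = a ^ 2 * stdNormalCDF ((a - m) / s) := by
    rw [setIntegral_congr_fun (g := fun _ => a ^ 2) measurableSet_Iic, setIntegral_const,
      smul_eq_mul, mul_comm]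
    · rfl
    · intro x hx
      have hxa : m + s * x ≤ a := by
        have := (le_div_iff₀ hs).1 hx
        linarith
      simp [clip, hxa]
  have hmid : ∫ x in Set.Ioc ((a - m) / s) ((b - m) / s), (clip a b (m + s * x)) ^ 2
        ∂(gaussianReal 0 1)
      = ∫ x in Set.Ioc ((a - m) / s) ((b - m) / s), (m + s * x) ^ 2 ∂(gaussianReal 0 1) := by
    refine setIntegral_congr_fun measurableSet_Ioc fun x hx => ?_
    have hax : a ≤ m + s * x := by
      have := (div_lt_iff₀ hs).1 hx.1
      linarith
    have hxb : m + s * x ≤ b := by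
      have := (le_div_iff₀ hs).1 hx.2
      linarith
    simp [clip, hax, hxb]
  have hhigh : ∫ x in Set.Ioi ((b - m) / s), (clip a b (m + s * x)) ^ 2 ∂(gaussianReal 0 1)
      = b ^ 2 * (1 - stdNormalCDF ((b - m) / s)) := by
    rw [setIntegral_congr_fun (g := fun _ => b ^ 2) measurableSet_Ioi, setIntegral_const,
      smul_eq_mul, mul_comm, measureReal_Ioi_stdGaussian]
    intro x hx
    have hbx : b ≤ m + s * x := by
      have := (div_lt_iff₀ hs).1 hx
      linarith
    simp [clip, hbx, hab.le]
  rw [hlaw, integral_eq_integral_Iic_add_Ioc_add_Ioi hint hAB, hlow, hmid, hhigh,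
    setIntegral_Ioc_affine_sq_stdGaussian m s hAB]
  ring
end

section
/- Let X ~ N(m, s²) with s > 0 and W ~ N(0, τ²) be independent real Gaussian random variables, let c, μ ∈ ℝ, and set Y = μ + c·(X − m) + W, so that (X, Y) is jointly Gaussian with Cov(X, Y) = c·s². Let a < b be censoring limits and P = Φ((b − m)/s) − Φ((a − m)/s). Then Cov(Y, clip_{a,b}(X)) = P·c·s², i.e. Cov(Y, clip_{a,b}(X)) = P·Cov(Y, X). -/
open MeasureTheory ProbabilityTheory Real

/-- The covariance of two real random variables: Cov(Y, Z) = E[YZ] − E[Y]E[Z]. -/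
noncomputable def cov {Ω : Type*} [MeasureSpace Ω] (Y Z : Ω → ℝ) : ℝ :=
  (∫ ω, Y ω * Z ω ∂ℙ) - (∫ ω, Y ω ∂ℙ) * (∫ ω, Z ω ∂ℙ)

open scoped NNReal Topology
open Set Filter

theorem hasDerivAt_gaussianPDFReal (m : ℝ) {v : ℝ≥0} (hv : v ≠ 0) (x : ℝ) :
    HasDerivAt (fun y => -v * gaussianPDFReal m v y) ((x - m) * gaussianPDFReal m v x) x := by
  have hv' : (v : ℝ) ≠ 0 := NNReal.coe_ne_zero.mpr hv
  have h : HasDerivAt (fun y : ℝ => -(y - m) ^ 2 / (2 * v)) (-(2 * (x - m)) / (2 * v)) x := by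
    simpa using ((((hasDerivAt_id x).sub_const m).pow 2).neg.div_const (2 * (v : ℝ)))
  simp only [gaussianPDFReal_def]
  refine ((h.exp.const_mul (√(2 * π * v))⁻¹).const_mul (-(v : ℝ))).congr_deriv ?_
  field_simp

theorem integrable_gaussianReal_iff (m : ℝ) {v : ℝ≥0} (hv : v ≠ 0) (f : ℝ → ℝ) :
    Integrable f (gaussianReal m v) ↔ Integrable (fun x => f x * gaussianPDFReal m v x) := by
  rw [gaussianReal_of_var_ne_zero _ hv,
    integrable_withDensity_iff (measurable_gaussianPDF m v) (ae_of_all _ fun _ => gaussianPDF_lt_top)]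
  simp only [toReal_gaussianPDF]

theorem measurable_clip (a b : ℝ) : Measurable (clip a b) := by
  unfold clip; fun_prop

theorem memLp_clip {Ω : Type*} [MeasurableSpace Ω] {μ : Measure Ω} [IsFiniteMeasure μ] {X : Ω → ℝ}
    (hX : Measurable X) {a b : ℝ} (hab : a ≤ b) (p : ENNReal) :
    MemLp (fun ω => clip a b (X ω)) p μ := by
  refine MemLp.of_bound ((measurable_clip a b).comp hX).aestronglyMeasurable (max |a| |b|)
    (ae_of_all _ fun ω => abs_le_max_abs_abs (le_max_left _ _) (max_le hab (min_le_left _ _)))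

/-- Stein's identity for the clipping map. -/
theorem integral_sub_mul_clip_gaussianReal (m : ℝ) {v : ℝ≥0} (hv : v ≠ 0) {a b : ℝ}
    (hab : a < b) :
    ∫ x, (x - m) * clip a b x ∂gaussianReal m v = v * (gaussianReal m v).real (Ioc a b) := by
  have hint : Integrable (fun x => (x - m) * clip a b x) (gaussianReal m v) := by
    refine MemLp.integrable_mul (p := 2) (q := 2) ?_ (memLp_clip measurable_id hab.le 2)
    exact (memLp_id_gaussianReal' 2 (by simp)).sub (memLp_const m)
  have hint' : Integrable (fun x => (x - m) * gaussianPDFReal m v x) := by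
    refine (integrable_gaussianReal_iff m hv (fun x => x - m)).mp ?_
    exact (((memLp_id_gaussianReal' 1 (by simp)).sub (memLp_const m)).integrable le_rfl)
  rw [integrable_gaussianReal_iff m hv] at hint
  have hf : Integrable (fun x => -v * gaussianPDFReal m v x) :=
    (integrable_gaussianPDFReal m v).const_mul _
  have hderiv := hasDerivAt_gaussianPDFReal m hv
  have htop : Tendsto (fun x => -v * gaussianPDFReal m v x) atTop (𝓝 0) :=
    tendsto_zero_of_hasDerivAt_of_integrableOn_Ioi (a := 0) (fun x _ => hderiv x)
      hint'.integrableOn hf.integrableOn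
  have hbot : Tendsto (fun x => -v * gaussianPDFReal m v x) atBot (𝓝 0) :=
    tendsto_zero_of_hasDerivAt_of_integrableOn_Iic (a := 0) (fun x _ => hderiv x)
      hint'.integrableOn hf.integrableOn
  have hIic : ∫ x in Iic a, (x - m) * clip a b x * gaussianPDFReal m v x
      = a * (-v * gaussianPDFReal m v a) := by
    rw [setIntegral_congr_fun (g := fun x => a * ((x - m) * gaussianPDFReal m v x))
      measurableSet_Iic]
    · rw [integral_const_mul, integral_Iic_of_hasDerivAt_of_tendsto' (fun x _ => hderiv x)
        hint'.integrableOn hbot, sub_zero]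
    · intro x hx
      have : clip a b x = a := max_eq_left ((min_le_right _ _).trans hx)
      simp only [this]; ring
  have hIoi : ∫ x in Ioi b, (x - m) * clip a b x * gaussianPDFReal m v x
      = b * (v * gaussianPDFReal m v b) := by
    rw [setIntegral_congr_fun (g := fun x => b * ((x - m) * gaussianPDFReal m v x))
      measurableSet_Ioi]
    · rw [integral_const_mul, integral_Ioi_of_hasDerivAt_of_tendsto' (fun x _ => hderiv x)
        hint'.integrableOn htop]
      ring
    · intro x hx
      have : clip a b x = b := by
        rw [clip, min_eq_left (le_of_lt hx), max_eq_right hab.le]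
      simp only [this]; ring
  have hcont : Continuous (gaussianPDFReal m v) := by
    rw [gaussianPDFReal_def]; fun_prop
  have hIoc : ∫ x in Ioc a b, (x - m) * clip a b x * gaussianPDFReal m v x
      = b * (-v * gaussianPDFReal m v b) - a * (-v * gaussianPDFReal m v a)
        + v * ∫ x in Ioc a b, gaussianPDFReal m v x := by
    rw [setIntegral_congr_fun (g := fun x => x * ((x - m) * gaussianPDFReal m v x))
      measurableSet_Ioc]
    · have h := intervalIntegral.integral_mul_deriv_eq_deriv_mul (a := a) (b := b)
        (fun x _ => hasDerivAt_id x) (fun x _ => hderiv x)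
        (Continuous.intervalIntegrable (by fun_prop) _ _) hint'.intervalIntegrable
      simp only [id, one_mul, intervalIntegral.integral_of_le hab.le, integral_const_mul] at h
      rw [h]; ring
    · intro x hx
      have : clip a b x = x := by
        rw [clip, min_eq_right hx.2, max_eq_right hx.1.le]
      simp only [this]; ring
  have hreal : (gaussianReal m v).real (Ioc a b) = ∫ x in Ioc a b, gaussianPDFReal m v x := by
    rw [measureReal_def, gaussianReal_apply_eq_integral m hv, ENNReal.toReal_ofReal]
    exact integral_nonneg fun x => gaussianPDFReal_nonneg m v x
  rw [integral_gaussianReal_eq_integral_smul hv, hreal]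
  simp only [smul_eq_mul, mul_comm (gaussianPDFReal m v _)]
  rw [← intervalIntegral.integral_Iic_add_Ioi (b := a) hint.integrableOn hint.integrableOn,
    ← Ioc_union_Ioi_eq_Ioi hab.le, setIntegral_union (Ioc_disjoint_Ioi le_rfl) measurableSet_Ioi
      hint.integrableOn hint.integrableOn, hIic, hIoc, hIoi]
  ring

theorem stdNormalCDF_standardize (m : ℝ) {s : ℝ} (hs : 0 < s) (x : ℝ) :
    stdNormalCDF ((x - m) / s) = (gaussianReal m (s ^ 2).toNNReal).real (Iic x) := by
  have h1 : (gaussianReal m (s ^ 2).toNNReal).map (fun y => (y - m) / s) = gaussianReal 0 1 := by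
    have : (fun y : ℝ => (y - m) / s) = (fun y => y / s) ∘ fun y => y - m := rfl
    rw [this, ← Measure.map_map (by fun_prop) (by fun_prop), gaussianReal_map_sub_const,
      gaussianReal_map_div_const]
    congr 1
    · simp
    · ext
      simp [hs.ne', sq_nonneg]
  rw [stdNormalCDF, ← h1, Measure.map_apply (by fun_prop) measurableSet_Iic, measureReal_def]
  congr 2
  ext y
  simp [div_le_div_iff_of_pos_right hs]

theorem gaussianReal_real_Ioc (m : ℝ) {s : ℝ} (hs : 0 < s) {a b : ℝ} (hab : a < b) :
    (gaussianReal m (s ^ 2).toNNReal).real (Ioc a b)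
      = stdNormalCDF ((b - m) / s) - stdNormalCDF ((a - m) / s) := by
  rw [stdNormalCDF_standardize m hs, stdNormalCDF_standardize m hs, ← Iic_sdiff_Iic,
    measureReal_sdiff (Iic_subset_Iic.mpr hab.le) measurableSet_Iic]

theorem cov_eq_covariance {Ω : Type*} [MeasureSpace Ω] [IsProbabilityMeasure (ℙ : Measure Ω)]
    {Y Z : Ω → ℝ} (hY : MemLp Y 2 ℙ) (hZ : MemLp Z 2 ℙ) : cov Y Z = covariance Y Z ℙ :=
  (covariance_eq_sub hY hZ).symm

/-- Only the regression slope of `Y` on `X` enters the covariance of `Y` with a function of `X`. -/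
theorem covariance_linear_regression {Ω : Type*} [MeasurableSpace Ω] {μ : Measure Ω}
    [IsProbabilityMeasure μ] {X W : Ω → ℝ} (hX : MemLp X 2 μ) (hW : MemLp W 2 μ)
    (hindep : IndepFun X W μ) {g : ℝ → ℝ} (hg : Measurable g)
    (hgX : MemLp (fun ω => g (X ω)) 2 μ) (d c m : ℝ) :
    covariance (fun ω => d + c * (X ω - m) + W ω) (fun ω => g (X ω)) μ
      = c * covariance X (fun ω => g (X ω)) μ := by
  have hXm : MemLp (fun ω => X ω - m) 2 μ := hX.sub (memLp_const m)
  have h1 : MemLp (fun ω => d + c * (X ω - m)) 2 μ := (memLp_const d).add (hXm.const_mul c)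
  have h2 : covariance W (fun ω => g (X ω)) μ = 0 :=
    (hindep.symm.comp measurable_id hg).covariance_eq_zero hW hgX
  change covariance ((fun ω => d + c * (X ω - m)) + W) _ μ = _
  rw [covariance_add_left h1 hW hgX, h2,
    covariance_const_add_left ((hXm.const_mul c).integrable (by norm_num)),
    covariance_const_mul_left, covariance_sub_const_left (hX.integrable (by norm_num)), add_zero]

theorem cov_censored_bivariate {Ω : Type*} [MeasureSpace Ω]
    [IsProbabilityMeasure (ℙ : Measure Ω)]
    (X W : Ω → ℝ) (hXm : Measurable X) (hWm : Measurable W)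
    (m s τ μy c a b : ℝ) (hs : 0 < s) (hab : a < b)
    (hX : Measure.map X ℙ = gaussianReal m ((s ^ 2).toNNReal))
    (hW : Measure.map W ℙ = gaussianReal 0 ((τ ^ 2).toNNReal))
    (hindep : IndepFun X W ℙ)
    (Y : Ω → ℝ) (hY : Y = fun ω => μy + c * (X ω - m) + W ω) :
    cov Y (fun ω => clip a b (X ω)) =
        (stdNormalCDF ((b - m) / s) - stdNormalCDF ((a - m) / s)) * (c * s ^ 2)
      ∧ cov Y (fun ω => clip a b (X ω)) =
        (stdNormalCDF ((b - m) / s) - stdNormalCDF ((a - m) / s)) * cov Y X := by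
  have hv : (s ^ 2).toNNReal ≠ 0 := by simpa using hs.ne'
  have hvs : ((s ^ 2).toNNReal : ℝ) = s ^ 2 := Real.coe_toNNReal _ (sq_nonneg s)
  have hXL : MemLp X 2 ℙ := by
    have h := memLp_id_gaussianReal' (μ := m) (v := (s ^ 2).toNNReal) 2 (by simp)
    rw [← hX] at h
    exact h.comp_of_map hXm.aemeasurable
  have hWL : MemLp W 2 ℙ := by
    have h := memLp_id_gaussianReal' (μ := 0) (v := (τ ^ 2).toNNReal) 2 (by simp)
    rw [← hW] at h
    exact h.comp_of_map hWm.aemeasurable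
  have hCL : MemLp (fun ω => clip a b (X ω)) 2 (ℙ : Measure Ω) := memLp_clip hXm hab.le 2
  have hYL : MemLp Y 2 ℙ := by
    rw [hY]
    exact ((memLp_const μy).add ((hXL.sub (memLp_const m)).const_mul c)).add hWL
  have hEX : ∫ ω, X ω ∂ℙ = m := by
    rw [← integral_id_gaussianReal (μ := m) (v := (s ^ 2).toNNReal), ← hX,
      integral_map hXm.aemeasurable (by fun_prop)]
  have hXX : covariance X X ℙ = s ^ 2 := by
    rw [covariance_self hXm.aemeasurable, ← hvs,
      ← variance_fun_id_gaussianReal (μ := m) (v := (s ^ 2).toNNReal), ← hX,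
      variance_map (by fun_prop) hXm.aemeasurable]
    rfl
  have hXC : covariance X (fun ω => clip a b (X ω)) ℙ
      = s ^ 2 * (stdNormalCDF ((b - m) / s) - stdNormalCDF ((a - m) / s)) := by
    have hmeas : AEStronglyMeasurable (fun x => (x - m) * clip a b x) (Measure.map X ℙ) :=
      ((measurable_id.sub_const m).mul (measurable_clip a b)).aestronglyMeasurable
    rw [← gaussianReal_real_Ioc m hs hab, ← hvs, Real.toNNReal_coe,
      ← integral_sub_mul_clip_gaussianReal m hv hab, ← hX, integral_map hXm.aemeasurable hmeas,
      ← covariance_sub_const_left (hXL.integrable (by norm_num)) m,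
      covariance_eq_sub (X := fun ω => X ω - m) (hXL.sub (memLp_const m)) hCL,
      integral_sub (hXL.integrable (by norm_num)) (integrable_const m), hEX]
    simp
  have hYC := covariance_linear_regression hXL hWL hindep (measurable_clip a b) hCL μy c m
  have hYX := covariance_linear_regression hXL hWL hindep measurable_id hXL μy c m
  simp only [id] at hYX
  rw [cov_eq_covariance hYL hCL, cov_eq_covariance hYL hXL, hY, hYC, hYX, hXC, hXX]
  constructor <;> ring
end
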